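/- arXiv:2102.02869 — 2 statements merged into one kernel-verified Lean document; each statement's English description precedes it below -/
import Mathlib

section
/- Let m, n, λ, r be positive integers. If (i) 3 divides r·m, (ii) 2 divides r·n·m, and (iii) r divides 3·λ·(n−1)·C(m,2), then the hypergraph λ𝒦³_{m×n} admits an r-factorization, i.e., its edge multiset can be partitioned into spanning r-regular sub-hypergraphs. -/
/-!
Hypergraphs are modeled with edge multisets: an edge is a multi-subset of the
vertex set (a `Multiset V`), and the edge collection is a `Multiset (Multiset V)`.
-/

/-- The degree of a vertex `v` in the edge multiset `E`: the total number of
occurrences of `v` among all edges (counted with multiplicity). -/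
def hdeg {V : Type*} [DecidableEq V] (E : Multiset (Multiset V)) (v : V) : ℕ :=
  (E.map fun e => e.count v).sum

/-- The complete 3-uniform multipartite hypergraph `𝒦³_{m×n}` on vertex set
`Fin n × Fin m` (part `i` is `{i} × Fin m`), whose edges are exactly the
multisets `{(i,j), (i,j'), (k,l)}` with `j ≠ j'` and `i ≠ k`, each with
multiplicity `1`. -/
def K3mn (n m : ℕ) : Multiset (Multiset (Fin n × Fin m)) :=
  (Finset.image
    (fun t : Fin n × Fin m × Fin m × Fin n × Fin m =>
      ({(t.1, t.2.1), (t.1, t.2.2.1), (t.2.2.2.1, t.2.2.2.2)} : Multiset (Fin n × Fin m)))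
    (Finset.univ.filter fun t : Fin n × Fin m × Fin m × Fin n × Fin m =>
      t.2.1 ≠ t.2.2.1 ∧ t.1 ≠ t.2.2.2.1)).val

/-- In a nonempty finite bipartite multigraph of minimum degree at least two, there is a nonzero
weighting of the edges that sums to zero around every vertex. -/
lemma exists_balanced_weight {E T C : Type*} [DecidableEq E] [DecidableEq T] [DecidableEq C]
    (F : Finset E) (hF : F.Nonempty) (τ : E → T) (f : E → C)
    (hτ : ∀ t ∈ F.image τ, 2 ≤ (F.filter (τ · = t)).card)
    (hf : ∀ c ∈ F.image f, 2 ≤ (F.filter (f · = c)).card) :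
    ∃ d : E → ℚ, (∃ e ∈ F, d e ≠ 0) ∧ (∀ t, ∑ e ∈ F with τ e = t, d e = 0) ∧
      ∀ c, ∑ e ∈ F with f e = c, d e = 0 := by
  obtain ⟨e₀, he₀⟩ := hF
  have hT : 2 * (F.image τ).card ≤ F.card := by
    rw [Finset.card_eq_sum_card_image τ F, mul_comm]
    simpa using Finset.card_nsmul_le_sum _ _ 2 hτ
  have hC : 2 * (F.image f).card ≤ F.card := by
    rw [Finset.card_eq_sum_card_image f F, mul_comm]
    simpa using Finset.card_nsmul_le_sum _ _ 2 hf
  let M : Matrix (((F.image τ).erase (τ e₀)) ⊕ (F.image f)) F ℚ :=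
    Matrix.of fun v e => Sum.elim (fun t => if τ e = t.1 then 1 else 0)
      (fun c => if f e = c.1 then 1 else 0) v
  have hlt : Module.finrank ℚ ((((F.image τ).erase (τ e₀)) ⊕ (F.image f)) → ℚ)
      < Module.finrank ℚ (F → ℚ) := by
    have h := Finset.card_erase_lt_of_mem (Finset.mem_image_of_mem τ he₀)
    simp only [Module.finrank_fintype_fun_eq_card, Fintype.card_sum, Fintype.card_coe]
    omega
  obtain ⟨y, hy, hy0⟩ := Submodule.exists_mem_ne_zero_of_ne_bot
    (LinearMap.ker_ne_bot_of_finrank_lt (f := M.mulVecLin) hlt)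
  have hMy : ∀ v, ∑ e, M v e * y e = 0 := fun v => congrFun (LinearMap.mem_ker.1 hy) v
  let d : E → ℚ := fun e => if h : e ∈ F then y ⟨e, h⟩ else 0
  have hd : ∀ e : F, d e = y e := fun e => by simp [d]
  have hsum : ∀ (P : E → Prop) [DecidablePred P],
      ∑ e ∈ F with P e, d e = ∑ e : F, (if P e then 1 else 0) * y e := by
    intro P _
    rw [Finset.sum_filter, ← Finset.sum_coe_sort]
    simp [hd]
  have hCz : ∀ c, ∑ e ∈ F with f e = c, d e = 0 := by
    intro c
    by_cases hc : c ∈ F.image f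
    · rw [hsum]
      exact hMy (Sum.inr ⟨c, hc⟩)
    · rw [Finset.filter_false_of_mem, Finset.sum_empty]
      rintro e he rfl
      exact hc (Finset.mem_image_of_mem f he)
  have hTz : ∀ t, t ≠ τ e₀ → ∑ e ∈ F with τ e = t, d e = 0 := by
    intro t ht
    by_cases hc : t ∈ F.image τ
    · rw [hsum]
      exact hMy (Sum.inl ⟨t, Finset.mem_erase.2 ⟨ht, hc⟩⟩)
    · rw [Finset.filter_false_of_mem, Finset.sum_empty]
      rintro e he rfl
      exact hc (Finset.mem_image_of_mem τ he)
  refine ⟨d, ?_, fun t => ?_, hCz⟩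
  · obtain ⟨e, he⟩ := Function.ne_iff.1 hy0
    exact ⟨e, e.2, by rwa [hd]⟩
  · by_cases ht : t = τ e₀
    · have h1 : ∑ e ∈ F, d e = 0 := by
        rw [← Finset.sum_fiberwise_of_maps_to (fun e he => Finset.mem_image_of_mem f he)]
        exact Finset.sum_eq_zero fun c _ => hCz c
      rw [← Finset.sum_fiberwise_of_maps_to (fun e he => Finset.mem_image_of_mem τ he),
        Finset.sum_eq_single (τ e₀) (fun t _ h => hTz t h)
          (fun h => absurd (Finset.mem_image_of_mem τ he₀) h)] at h1
      rw [ht, h1]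
    · exact hTz t ht

/-- A fiber in which a `[0, 1]`-weighting has an integral sum cannot contain exactly one
non-integral weight. -/
lemma two_le_card_fractional {E T : Type*} [Fintype E] [DecidableEq E] [DecidableEq T]
    (τ : E → T) (x : E → ℚ) (hx0 : ∀ e, 0 ≤ x e) (hx1 : ∀ e, x e ≤ 1) (β : T → ℕ)
    (hβ : ∀ t, ∑ e with τ e = t, x e = β t) :
    ∀ t ∈ (Finset.univ.filter fun e => x e ≠ 0 ∧ x e ≠ 1).image τ,
      2 ≤ ((Finset.univ.filter fun e => x e ≠ 0 ∧ x e ≠ 1).filter (τ · = t)).card := by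
  intro t ht
  obtain ⟨e, he, rfl⟩ := Finset.mem_image.1 ht
  by_contra! hlt
  have hone : ∀ e', τ e' = τ e → e' ≠ e → x e' = 0 ∨ x e' = 1 := by
    intro e' h1 h2
    by_contra! h
    exact h2 (Finset.card_le_one.1 (Nat.lt_succ_iff.1 hlt) e' (by simp [h, h1]) e
      (by simpa using he))
  have hs := hβ (τ e)
  rw [← Finset.add_sum_erase _ _ (show e ∈ Finset.univ.filter (τ · = τ e) by simp)] at hs
  have hint : ∑ e' ∈ (Finset.univ.filter (τ · = τ e)).erase e, x e' =
      (((Finset.univ.filter (τ · = τ e)).erase e).filter (x · = 1)).card := by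
    rw [Finset.card_filter, Nat.cast_sum]
    refine Finset.sum_congr rfl fun e' he' => ?_
    rw [Finset.mem_erase, Finset.mem_filter] at he'
    rcases hone e' he'.2.2 he'.1 with h | h <;> simp [h]
  rw [hint] at hs
  have hz : x e = ((β (τ e) : ℤ) - ((((Finset.univ.filter (τ · = τ e)).erase e).filter
    (x · = 1)).card : ℤ) : ℤ) := by
    push_cast
    linarith
  simp only [Finset.mem_filter, Finset.mem_univ, true_and] at he
  have h0 := lt_of_le_of_ne (hx0 e) he.1.symm
  have h1 := lt_of_le_of_ne (hx1 e) he.2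
  rw [hz] at h0 h1
  norm_cast at h0 h1
  omega

/-- If a point of the unit cube is moved along a nonzero direction supported on its non-integral
coordinates, then the boundary of the cube can be met in a point with fewer
non-integral coordinates. -/
lemma exists_step_to_boundary {E : Type*} [Fintype E] (x d : E → ℚ)
    (hx0 : ∀ e, 0 ≤ x e) (hx1 : ∀ e, x e ≤ 1) (hd : ∃ e, d e ≠ 0)
    (hsupp : ∀ e, d e ≠ 0 → x e ≠ 0 ∧ x e ≠ 1) :
    ∃ s : ℚ, (∀ e, 0 ≤ x e + s * d e) ∧ (∀ e, x e + s * d e ≤ 1) ∧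
      ((Finset.univ.filter fun e => x e + s * d e ≠ 0 ∧ x e + s * d e ≠ 1).card
        < (Finset.univ.filter fun e => x e ≠ 0 ∧ x e ≠ 1).card) := by
  let h : E → ℚ := fun e => if 0 < d e then (1 - x e) / d e else x e / (-d e)
  obtain ⟨e₁, he₁⟩ := hd
  obtain ⟨e₀, he₀, hmin⟩ := Finset.exists_min_image (Finset.univ.filter fun e => d e ≠ 0) h
    ⟨e₁, by simpa using he₁⟩
  simp only [Finset.mem_filter, Finset.mem_univ, true_and] at he₀ hmin
  have hnn : 0 ≤ h e₀ := by
    simp only [h]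
    split_ifs with hp
    · exact div_nonneg (by linarith [hx1 e₀]) hp.le
    · exact div_nonneg (hx0 e₀) (by linarith)
  have key : ∀ e, 0 ≤ x e + h e₀ * d e ∧ x e + h e₀ * d e ≤ 1 := by
    intro e
    rcases lt_trichotomy (d e) 0 with hn | hz | hp
    · have h1 := hmin e hn.ne
      simp only [show h e = x e / (-d e) by simp [h, hn.le.not_gt]] at h1
      rw [le_div_iff₀ (by linarith)] at h1
      constructor
      · linarith
      · nlinarith [hx1 e]
    · simp [hz, hx0 e, hx1 e]
    · have h1 := hmin e hp.ne'
      simp only [show h e = (1 - x e) / d e by simp [h, hp]] at h1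
      rw [le_div_iff₀ hp] at h1
      constructor
      · nlinarith [hx0 e]
      · linarith
  refine ⟨h e₀, fun e => (key e).1, fun e => (key e).2, Finset.card_lt_card ?_⟩
  rw [Finset.ssubset_iff_of_subset]
  · refine ⟨e₀, by simpa using hsupp e₀ he₀, ?_⟩
    simp only [Finset.mem_filter, Finset.mem_univ, true_and, not_and_or, not_not]
    by_cases hp : 0 < d e₀
    · right
      simp only [h, hp, if_true]
      field_simp
      ring
    · left
      simp only [h, hp, if_false]
      field_simp
      ring
  · intro e
    simp only [Finset.mem_filter, Finset.mem_univ, true_and]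
    intro he
    by_cases hz : d e = 0
    · simpa [hz] using he
    · exact hsupp e hz

/-- Integrality of bipartite degree-constrained subgraphs: a fractional edge set of a bipartite
multigraph with integral degrees can be replaced by an edge set with the same degrees. -/
theorem exists_finset_of_fractional {E T C : Type*} [Fintype E] [DecidableEq E] [DecidableEq T]
    [DecidableEq C] (τ : E → T) (f : E → C) (β : T → ℕ) (γ : C → ℕ) (x : E → ℚ)
    (hx0 : ∀ e, 0 ≤ x e) (hx1 : ∀ e, x e ≤ 1)
    (hβ : ∀ t, ∑ e with τ e = t, x e = β t) (hγ : ∀ c, ∑ e with f e = c, x e = γ c) :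
    ∃ B : Finset E, (∀ t, (B.filter (τ · = t)).card = β t) ∧
      ∀ c, (B.filter (f · = c)).card = γ c := by
  induction hN : (Finset.univ.filter fun e => x e ≠ 0 ∧ x e ≠ 1).card
    using Nat.strong_induction_on generalizing x with
  | _ N ih =>
  set F := Finset.univ.filter fun e => x e ≠ 0 ∧ x e ≠ 1 with hFdef
  rcases F.eq_empty_or_nonempty with hF | hF
  · have hx : ∀ e, x e = if x e = 1 then 1 else 0 := by
      intro e
      have : e ∉ F := by simp [hF]
      simp only [hFdef, Finset.mem_filter, Finset.mem_univ, true_and, not_and_or, not_not] at this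
      rcases this with h | h <;> simp [h]
    have hcard : ∀ (P : E → Prop) [DecidablePred P],
        (((Finset.univ.filter (x · = 1)).filter P).card : ℚ) = ∑ e with P e, x e := by
      intro P _
      rw [Finset.filter_comm, Finset.card_filter, Nat.cast_sum]
      refine Finset.sum_congr rfl fun e _ => ?_
      conv_rhs => rw [hx e]
      push_cast
      rfl
    refine ⟨Finset.univ.filter (x · = 1), fun t => ?_, fun c => ?_⟩
    · exact_mod_cast (hcard _).trans (hβ t)
    · exact_mod_cast (hcard _).trans (hγ c)
  · obtain ⟨d, ⟨e₀, he₀, hde₀⟩, hdτ, hdf⟩ := exists_balanced_weight F hF τ f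
      (two_le_card_fractional τ x hx0 hx1 β hβ) (two_le_card_fractional f x hx0 hx1 γ hγ)
    let d' : E → ℚ := fun e => if e ∈ F then d e else 0
    have hd' : ∀ (P : E → Prop) [DecidablePred P],
        ∑ e with P e, d' e = ∑ e ∈ F with P e, d e := by
      intro P _
      simp only [d', Finset.sum_ite, Finset.sum_const_zero, add_zero]
      congr 1
      ext e
      simp [and_comm]
    obtain ⟨s, hs0, hs1, hlt⟩ := exists_step_to_boundary x d' hx0 hx1
      ⟨e₀, by simpa [d', he₀] using hde₀⟩ (fun e he => by
        have : e ∈ F := by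
          by_contra hc
          simp [d', hc] at he
        simpa [hFdef] using this)
    refine ih _ (hN ▸ hlt) (fun e => x e + s * d' e) hs0 hs1 (fun t => ?_) (fun c => ?_) rfl
    · rw [Finset.sum_add_distrib, ← Finset.mul_sum, hd', hdτ, hβ, mul_zero, add_zero]
    · rw [Finset.sum_add_distrib, ← Finset.mul_sum, hd', hdf, hγ, mul_zero, add_zero]

/-- One detachment step. If the coloring `f` has the right degrees at the vertices of `S` and in
every part, then it can be recolored so as to have the right degree at one more vertex `a`. -/
lemma exists_recoloring_insert {E V I C : Type*} [Fintype E] [DecidableEq E] [Fintype V]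
    [DecidableEq V] [DecidableEq I] [DecidableEq C] (N : E → Finset V) (part : V → I)
    (hsymm : ∀ a b, part a = part b →
      ∃ σ : Equiv.Perm E, ∀ e, N (σ e) = (N e).map (Equiv.swap a b).toEmbedding)
    (r : ℕ) (S : Finset V) (a : V) (ha : a ∉ S) (f : E → C)
    (hS : ∀ c, ∀ v ∈ S, (Finset.univ.filter fun e => f e = c ∧ v ∈ N e).card = r)
    (hpart : ∀ c i, ∑ e with f e = c, ((N e).filter (part · = i)).card
      = r * (Finset.univ.filter (part · = i)).card) :
    ∃ f' : E → C,
      (∀ c, ∀ v ∈ insert a S, (Finset.univ.filter fun e => f' e = c ∧ v ∈ N e).card = r) ∧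
      ∀ c i, ∑ e with f' e = c, ((N e).filter (part · = i)).card
        = r * (Finset.univ.filter (part · = i)).card := by
  classical
  let R : Finset V := Finset.univ.filter fun v => part v = part a ∧ v ∉ S
  have haR : a ∈ R := by simp [R, ha]
  have hR0 : (0 : ℚ) < R.card := by exact_mod_cast Finset.card_pos.2 ⟨a, haR⟩
  let τ : E → Finset V × (I → ℕ) :=
    fun e => (N e ∩ S, fun i => ((N e).filter (part · = i)).card)
  have hdouble : ∀ (P : E → Prop) [DecidablePred P] (U : Finset V),
      ∑ e with P e, (N e ∩ U).card
        = ∑ v ∈ U, (Finset.univ.filter fun e => P e ∧ v ∈ N e).card := by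
    intro P _ U
    have := Finset.sum_card_bipartiteAbove_eq_sum_card_bipartiteBelow
      (s := Finset.univ.filter P) (t := U) (fun e v => v ∈ N e)
    simp only [Finset.bipartiteAbove, Finset.bipartiteBelow, Finset.filter_filter] at this
    rw [← this]
    refine Finset.sum_congr rfl fun e _ => ?_
    congr 1
    ext v
    simp [and_comm]
  have hτ : ∀ t, ∑ e with τ e = t, ((N e ∩ R).card : ℚ) / R.card
      = ((Finset.univ.filter fun e => τ e = t ∧ a ∈ N e).card : ℕ) := by
    intro t
    rw [← Finset.sum_div, div_eq_iff hR0.ne']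
    have h1 : ∀ v ∈ R, (Finset.univ.filter fun e => τ e = t ∧ v ∈ N e).card
        = (Finset.univ.filter fun e => τ e = t ∧ a ∈ N e).card := by
      intro v hv
      simp only [R, Finset.mem_filter, Finset.mem_univ, true_and] at hv
      obtain ⟨σ, hσ⟩ := hsymm a v hv.1.symm
      have hpt : ∀ u, part (Equiv.swap a v u) = part u := by
        intro u
        rw [Equiv.swap_apply_def]
        split_ifs with h h
        · rw [h, hv.1]
        · rw [h, hv.1]
        · rfl
      have hmem : ∀ e u, u ∈ N (σ e) ↔ Equiv.swap a v u ∈ N e := by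
        intro e u
        rw [hσ, Finset.mem_map_equiv, Equiv.symm_swap]
      have hτσ : ∀ e, τ (σ e) = τ e := by
        intro e
        refine Prod.ext ?_ (funext fun i => ?_)
        · ext u
          simp only [τ, Finset.mem_inter, hmem]
          refine and_congr_left fun hu => ?_
          rw [Equiv.swap_apply_of_ne_of_ne (ne_of_mem_of_not_mem hu ha)
            (ne_of_mem_of_not_mem hu hv.2)]
        · simp only [τ, hσ, Finset.filter_map, Finset.card_map]
          congr 1
          ext u
          simp [hpt]
      symm
      refine Finset.card_equiv σ fun e => ?_
      simp [hτσ, hmem]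
    have h2 := hdouble (τ · = t) R
    rw [Finset.sum_congr rfl h1, Finset.sum_const, smul_eq_mul] at h2
    rw [mul_comm]
    exact_mod_cast h2
  have hf : ∀ c, ∑ e with f e = c, ((N e ∩ R).card : ℚ) / R.card = (r : ℕ) := by
    intro c
    rw [← Finset.sum_div, div_eq_iff hR0.ne']
    have hsplit : Finset.univ.filter (part · = part a)
        = (Finset.univ.filter fun v => part v = part a ∧ v ∈ S) ∪ R := by
      ext v
      simp only [R, Finset.mem_filter, Finset.mem_univ, true_and, Finset.mem_union]
      tauto
    have hdisj : Disjoint (Finset.univ.filter fun v => part v = part a ∧ v ∈ S) R := by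
      rw [Finset.disjoint_left]
      simp +contextual [R]
    have h1 := hpart c (part a)
    have h2 : ∀ e, (N e).filter (part · = part a)
        = N e ∩ Finset.univ.filter (part · = part a) := by
      intro e
      ext v
      simp
    have h3 : ∑ v with part v = part a ∧ v ∈ S,
        (Finset.univ.filter fun e => f e = c ∧ v ∈ N e).card
        = r * (Finset.univ.filter fun v => part v = part a ∧ v ∈ S).card := by
      rw [Finset.sum_congr rfl fun v hv => hS c v (Finset.mem_filter.1 hv).2.2,
        Finset.sum_const, smul_eq_mul, mul_comm]
    simp only [h2] at h1
    rw [hdouble, hsplit, Finset.sum_union hdisj, h3, Finset.card_union_of_disjoint hdisj,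
      mul_add, ← hdouble, Nat.add_left_cancel_iff] at h1
    exact_mod_cast h1
  obtain ⟨B, hBτ, hBf⟩ := exists_finset_of_fractional τ f _ (fun _ => r)
    (fun e => ((N e ∩ R).card : ℚ) / R.card) (fun e => by positivity)
    (fun e => (div_le_one hR0).2 (by exact_mod_cast Finset.card_le_card Finset.inter_subset_right))
    hτ hf
  have hfib : ∀ q : (Finset V × (I → ℕ)) × Prop,
      Nonempty ({e // (τ e, a ∈ N e) = q} ≃ {e // (τ e, e ∈ B) = q}) := by
    rintro ⟨t, P⟩
    refine ⟨Fintype.equivOfCardEq ?_⟩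
    rw [Fintype.card_subtype, Fintype.card_subtype]
    have hB : (Finset.univ.filter fun e => τ e = t ∧ e ∈ B).card
        = (Finset.univ.filter fun e => τ e = t ∧ a ∈ N e).card := by
      rw [← hBτ t]
      congr 1
      ext e
      simp [and_comm]
    by_cases hP : P
    · simp only [Prod.mk.injEq, hP, eq_iff_iff, iff_true, hB]
    · simp only [Prod.mk.injEq, hP, eq_iff_iff, iff_false]
      have h1 := Finset.card_filter_add_card_filter_not (s := Finset.univ.filter (τ · = t))
        (a ∈ N ·)
      have h2 := Finset.card_filter_add_card_filter_not (s := Finset.univ.filter (τ · = t))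
        (· ∈ B)
      simp only [Finset.filter_filter] at h1 h2
      omega
  let φ := fun q => (hfib q).some
  let σ : Equiv.Perm E := Equiv.ofFiberEquiv φ
  have hσ : ∀ e, (τ (σ e), σ e ∈ B) = (τ e, a ∈ N e) := fun e => Equiv.ofFiberEquiv_map φ e
  have hστ : ∀ e, τ (σ e) = τ e := fun e => (Prod.ext_iff.1 (hσ e)).1
  have hσB : ∀ e, σ e ∈ B ↔ a ∈ N e := fun e => iff_of_eq (Prod.ext_iff.1 (hσ e)).2
  refine ⟨f ∘ σ, fun c v hv => ?_, fun c i => ?_⟩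
  · rcases Finset.mem_insert.1 hv with rfl | hv
    · rw [← hBf c]
      refine Finset.card_equiv σ fun e => ?_
      simp [hσB, and_comm]
    · rw [← hS c v hv]
      refine Finset.card_equiv σ fun e => ?_
      have := congrArg (v ∈ ·.1) (hστ e)
      simp only [τ, Finset.mem_inter, hv, and_true, eq_iff_iff] at this
      simp [this]
  · rw [← hpart c i]
    refine Finset.sum_equiv σ (fun e => by simp) fun e _ => ?_
    exact (congrFun (congrArg Prod.snd (hστ e)) i).symm

/-- Detachment theorem: if a hypergraph without repeated vertices in its edges is symmetric under
transpositions inside every part of a vertex partition, then an edge coloring in which every color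
class has average degree `r` in every part yields one in which every color class is
`r`-regular. -/
theorem exists_regular_coloring {E V I C : Type*} [Fintype E] [Fintype V]
    [DecidableEq V] [DecidableEq I] [DecidableEq C] (N : E → Finset V) (part : V → I)
    (hsymm : ∀ a b, part a = part b →
      ∃ σ : Equiv.Perm E, ∀ e, N (σ e) = (N e).map (Equiv.swap a b).toEmbedding)
    (r : ℕ) (f : E → C)
    (hpart : ∀ c i, ∑ e with f e = c, ((N e).filter (part · = i)).card
      = r * (Finset.univ.filter (part · = i)).card) :
    ∃ f' : E → C, ∀ c v, (Finset.univ.filter fun e => f' e = c ∧ v ∈ N e).card = r := by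
  classical
  have key : ∀ S : Finset V, ∃ f' : E → C,
      (∀ c, ∀ v ∈ S, (Finset.univ.filter fun e => f' e = c ∧ v ∈ N e).card = r) ∧
      ∀ c i, ∑ e with f' e = c, ((N e).filter (part · = i)).card
        = r * (Finset.univ.filter (part · = i)).card := by
    intro S
    induction S using Finset.induction_on with
    | empty => exact ⟨f, by simp, hpart⟩
    | insert a S ha ih =>
      obtain ⟨g, hg, hg'⟩ := ih
      exact exists_recoloring_insert N part hsymm r S a ha g hg hg'
  obtain ⟨f', hf', -⟩ := key Finset.univ
  exact ⟨f', fun c v => hf' c v (Finset.mem_univ v)⟩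

/-- Labels for the edges of `K3mn n m`: the part containing two vertices, the nonzero difference
to the other part, the pair of vertices in the former and the vertex in the latter. -/
abbrev EdgeLabel (n m : ℕ) [NeZero n] : Type :=
  Fin n × {δ : Fin n // δ ≠ 0} × {p : Finset (Fin m) // p.card = 2} × Fin m

/-- The vertex set of the edge with a given label. -/
def edgeVerts {n m : ℕ} [NeZero n] (e : EdgeLabel n m) : Finset (Fin n × Fin m) :=
  insert (e.1 + e.2.1, e.2.2.2) (e.2.2.1.1.map ⟨Prod.mk e.1, Prod.mk_right_injective e.1⟩)

section EdgeLabel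

variable {n m : ℕ} [NeZero n]

lemma mem_edgeVerts {e : EdgeLabel n m} {v : Fin n × Fin m} :
    v ∈ edgeVerts e ↔
      (v.1 = e.1 + e.2.1 ∧ v.2 = e.2.2.2) ∨ (v.1 = e.1 ∧ v.2 ∈ e.2.2.1.1) := by
  obtain ⟨i, j⟩ := v
  simp only [edgeVerts, Finset.mem_insert, Prod.mk.injEq, Finset.mem_map,
    Function.Embedding.coeFn_mk]
  refine or_congr Iff.rfl ⟨?_, ?_⟩
  · rintro ⟨_, h, rfl, rfl⟩
    exact ⟨rfl, h⟩
  · rintro ⟨rfl, h⟩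
    exact ⟨j, h, rfl, rfl⟩

lemma card_edgeVerts_filter (e : EdgeLabel n m) (i : Fin n) :
    ((edgeVerts e).filter (·.1 = i)).card
      = (if e.1 + e.2.1 = i then 1 else 0) + 2 * (if e.1 = i then 1 else 0) := by
  obtain ⟨k, ⟨δ, hδ⟩, ⟨p, hp⟩, l⟩ := e
  have hk : k + δ ≠ k := by simpa using hδ
  rw [edgeVerts, Finset.filter_insert, Finset.filter_map]
  by_cases h1 : k = i
  · subst h1
    simp [hk, hp]
  · by_cases h2 : k + δ = i <;> simp [h1, h2]

lemma edgeVerts_injective : Function.Injective (edgeVerts (n := n) (m := m)) := by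
  intro e e' h
  have hc : ∀ i, (if e.1 + e.2.1 = i then 1 else 0) + 2 * (if e.1 = i then 1 else 0)
      = (if e'.1 + e'.2.1 = i then 1 else 0) + 2 * (if e'.1 = i then 1 else 0) := by
    intro i
    rw [← card_edgeVerts_filter, ← card_edgeVerts_filter, h]
  have hm : ∀ i j, _ := fun i j => (mem_edgeVerts (e := e) (v := (i, j))).symm.trans
    (h ▸ mem_edgeVerts (e := e') (v := (i, j)))
  obtain ⟨k, ⟨δ, hδ⟩, ⟨p, hp⟩, l⟩ := e
  obtain ⟨k', ⟨δ', hδ'⟩, ⟨p', hp'⟩, l'⟩ := e'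
  have hk : k + δ ≠ k := by simpa using hδ
  have hk' : k' + δ' ≠ k' := by simpa using hδ'
  simp only at hc hm
  have h1 : k = k' := by
    have := hc k
    by_contra hne
    simp only [hk, Ne.symm hne, if_true, if_false] at this
    split_ifs at this <;> omega
  subst h1
  have h2 : δ = δ' := by
    have := hc (k + δ)
    by_contra hne
    simp [hk.symm, Ne.symm hne] at this
  subst h2
  have h3 : p = p' := by
    ext j
    simpa [hk.symm] using hm k j
  have h4 : l = l' := by
    simpa [hk] using hm (k + δ) l
  subst h3 h4
  rfl

/-- The permutation of the edge labels induced by a family of permutations of the parts. -/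
def edgePerm (g : Fin n → Equiv.Perm (Fin m)) : Equiv.Perm (EdgeLabel n m) where
  toFun e := (e.1, e.2.1, ⟨e.2.2.1.1.map (g e.1).toEmbedding, by
    rw [Finset.card_map, e.2.2.1.2]⟩, g (e.1 + e.2.1) e.2.2.2)
  invFun e := (e.1, e.2.1, ⟨e.2.2.1.1.map (g e.1).symm.toEmbedding, by
    rw [Finset.card_map, e.2.2.1.2]⟩, (g (e.1 + e.2.1)).symm e.2.2.2)
  left_inv e := by
    obtain ⟨k, δ, ⟨p, hp⟩, l⟩ := e
    simp [Finset.map_map, Equiv.toEmbedding]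
  right_inv e := by
    obtain ⟨k, δ, ⟨p, hp⟩, l⟩ := e
    simp [Finset.map_map]

lemma mem_edgeVerts_edgePerm (g : Fin n → Equiv.Perm (Fin m)) (e : EdgeLabel n m)
    (v : Fin n × Fin m) :
    v ∈ edgeVerts (edgePerm g e) ↔ (v.1, (g v.1).symm v.2) ∈ edgeVerts e := by
  obtain ⟨i, j⟩ := v
  simp only [mem_edgeVerts, edgePerm, Equiv.coe_fn_mk, Finset.mem_map_equiv,
    Equiv.symm_apply_eq]
  refine or_congr (and_congr_right ?_) (and_congr_right ?_)
  · rintro rfl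
    rfl
  · rintro rfl
    rfl

lemma exists_edgePerm_swap (a b : Fin n × Fin m) (hab : a.1 = b.1) :
    ∃ σ : Equiv.Perm (EdgeLabel n m),
      ∀ e, edgeVerts (σ e) = (edgeVerts e).map (Equiv.swap a b).toEmbedding := by
  obtain ⟨i, j⟩ := a
  obtain ⟨i', j'⟩ := b
  obtain rfl : i = i' := hab
  refine ⟨edgePerm (Function.update (fun _ => 1) i (Equiv.swap j j')), fun e => ?_⟩
  ext ⟨k, l⟩
  rw [mem_edgeVerts_edgePerm, Finset.mem_map_equiv, Equiv.symm_swap]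
  suffices h : (k, (Function.update (fun _ => (1 : Equiv.Perm (Fin m))) i
      (Equiv.swap j j') k).symm l) = Equiv.swap (i, j) (i, j') (k, l) by rw [← h]
  by_cases hk : k = i
  · subst hk
    simp only [Function.update_self, Equiv.symm_swap, Equiv.swap_apply_def, Prod.mk.injEq,
      true_and]
    split_ifs <;> rfl
  · rw [Equiv.swap_apply_of_ne_of_ne (by simp [hk]) (by simp [hk]),
      Function.update_of_ne hk]
    rfl

lemma map_edgeVerts_eq_K3mn :
    (Finset.univ : Finset (EdgeLabel n m)).val.map (fun e => (edgeVerts e).val) = K3mn n m := by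
  classical
  have hinj : Function.Injective fun e : EdgeLabel n m => (edgeVerts e).val :=
    Finset.val_injective.comp edgeVerts_injective
  rw [← Finset.image_val_of_injOn hinj.injOn, K3mn]
  congr 1
  have hval : ∀ (i k : Fin n) (j j' l : Fin m) (hj : j ≠ j') (hk : k - i ≠ 0),
      (edgeVerts (i, ⟨k - i, hk⟩, ⟨{j, j'}, Finset.card_pair hj⟩, l)).val
        = {(i, j), (i, j'), (k, l)} := by
    intro i k j j' l hj hk
    have hik : i ≠ k := fun h => hk (by simp [h])
    rw [Multiset.Nodup.ext (Finset.nodup _) (by simp [hj, hik])]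
    rintro ⟨u, w⟩
    rw [Finset.mem_val, mem_edgeVerts]
    simp
    tauto
  ext s
  simp only [Finset.mem_image, Finset.mem_univ, true_and, Finset.mem_filter, Prod.exists]
  constructor
  · rintro ⟨i, ⟨δ, hδ⟩, ⟨p, hp⟩, l, rfl⟩
    obtain ⟨j, j', hj, rfl⟩ := Finset.card_eq_two.1 hp
    refine ⟨i, j, j', i + δ, l, ⟨hj, by simpa using hδ⟩, ?_⟩
    rw [← hval i (i + δ) j j' l hj (by simpa using hδ)]
    simp
  · rintro ⟨i, j, j', k, l, ⟨hj, hik⟩, rfl⟩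
    exact ⟨i, ⟨k - i, sub_ne_zero.2 (Ne.symm hik)⟩, ⟨{j, j'}, Finset.card_pair hj⟩, l,
      hval i k j j' l hj _⟩

end EdgeLabel

lemma val_map_eq_sum_singleton {α β : Type*} (s : Finset α) (g : α → β) :
    s.val.map g = ∑ e ∈ s, {g e} := by
  rw [← Multiset.sum_map_singleton (s.val.map g), Multiset.map_map]
  rfl

/-- **Corollary (`r`-factorization of `λ𝒦³_{m×n}`).**
If `3 ∣ r m`, `2 ∣ r n m`, and `r ∣ 3 λ (n-1) C(m,2)`, then the edge multiset of
`λ𝒦³_{m×n}` can be partitioned into spanning `r`-regular sub-hypergraphs. -/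
theorem lambda_K3mn_r_factorization (m n lambda r : ℕ) (hm : 0 < m) (hn : 0 < n)
    (hlambda : 0 < lambda) (hr : 0 < r)
    (h1 : 3 ∣ r * m)
    (h2 : 2 ∣ r * n * m)
    (h3 : r ∣ 3 * lambda * (n - 1) * m.choose 2) :
    ∃ (k : ℕ) (F : Fin k → Multiset (Multiset (Fin n × Fin m))),
      (∑ i, F i) = lambda • K3mn n m ∧ ∀ i, ∀ v, hdeg (F i) v = r := by
  have : NeZero n := ⟨hn.ne'⟩
  obtain ⟨d, hd⟩ := h1
  obtain ⟨k, hk⟩ := h3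
  let Q := ({δ : Fin n // δ ≠ 0} × {p : Finset (Fin m) // p.card = 2} × Fin m) × Fin lambda
  have hQ : Fintype.card Q = Fintype.card (Fin k × Fin d) := by
    have hδ : Fintype.card {δ : Fin n // δ ≠ 0} = n - 1 := by
      simp [Fintype.card_subtype_compl]
    have hp : Fintype.card {p : Finset (Fin m) // p.card = 2} = m.choose 2 := by
      simp
    simp only [Q, Fintype.card_prod, hδ, hp, Fintype.card_fin]
    refine Nat.eq_of_mul_eq_mul_left (show 0 < 3 * r by positivity) ?_
    calc 3 * r * ((n - 1) * (m.choose 2 * m) * lambda)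
        = (3 * lambda * (n - 1) * m.choose 2) * (r * m) := by ring
      _ = 3 * r * (k * d) := by rw [hk, hd]; ring
  let φ : Q ≃ Fin k × Fin d := Fintype.equivOfCardEq hQ
  let N : EdgeLabel n m × Fin lambda → Finset (Fin n × Fin m) := fun e => edgeVerts e.1
  let f : EdgeLabel n m × Fin lambda → Fin k := fun e => (φ (e.1.2, e.2)).1
  obtain ⟨f', hf'⟩ := exists_regular_coloring N Prod.fst (fun a b hab => by
    obtain ⟨σ, hσ⟩ := exists_edgePerm_swap a b hab
    exact ⟨σ.prodCongr (Equiv.refl _), fun e => hσ e.1⟩) r f (fun c i => by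
    have hfib : (Finset.univ.filter fun q : Q => (φ q).1 = c).card = d := by
      rw [Finset.card_equiv (t := Finset.univ.filter fun y : Fin k × Fin d => y.1 = c) φ
        (fun q => by simp)]
      have : (Finset.univ.filter fun y : Fin k × Fin d => y.1 = c) = {c} ×ˢ Finset.univ := by
        ext y
        rw [Finset.mem_product]
        simp
      simp [this]
    have hi : (Finset.univ.filter fun v : Fin n × Fin m => v.1 = i).card = m := by
      have : (Finset.univ.filter fun v : Fin n × Fin m => v.1 = i) = {i} ×ˢ Finset.univ := by
        ext y
        rw [Finset.mem_product]
        simp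
      simp [this]
    let ψ : EdgeLabel n m × Fin lambda ≃ Fin n × Q := Equiv.prodAssoc _ _ _
    have hsum : ∑ e with f e = c, ((N e).filter (·.1 = i)).card
        = ∑ y ∈ Finset.univ ×ˢ (Finset.univ.filter fun q : Q => (φ q).1 = c),
          ((if y.1 + y.2.1.1.1 = i then 1 else 0) + 2 * (if y.1 = i then 1 else 0)) := by
      refine Finset.sum_equiv ψ (fun e => ?_) fun e _ => ?_
      · rw [Finset.mem_product]
        simp only [Finset.mem_filter, Finset.mem_univ, true_and]
        rfl
      · exact card_edgeVerts_filter e.1 i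
    rw [hsum, hi, hd, Finset.sum_product_right]
    have hone : ∀ q : Q, ∑ y : Fin n,
        ((if y + q.1.1.1 = i then 1 else 0) + 2 * (if y = i then 1 else 0)) = 3 := by
      intro q
      simp [Finset.sum_add_distrib, ← eq_sub_iff_add_eq]
    rw [Finset.sum_congr rfl fun q _ => hone q, Finset.sum_const, hfib, smul_eq_mul, mul_comm])
  refine ⟨k, fun c => (Finset.univ.filter (f' · = c)).val.map fun e => (N e).val, ?_, ?_⟩
  · have hsplit : ∑ c, (Finset.univ.filter (f' · = c)).val.map (fun e => (N e).val)
        = (Finset.univ : Finset (EdgeLabel n m × Fin lambda)).val.map fun e => (N e).val := by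
      simp only [val_map_eq_sum_singleton]
      exact Finset.sum_fiberwise _ _ _
    rw [hsplit, ← map_edgeVerts_eq_K3mn]
    rw [val_map_eq_sum_singleton, val_map_eq_sum_singleton, Fintype.sum_prod_type_right]
    simp [N]
  · intro c v
    rw [hdeg, Multiset.map_map, ← hf' c v, ← Finset.filter_filter, Finset.card_filter]
    refine Finset.sum_congr rfl fun e _ => ?_
    simp [Multiset.count_eq_of_nodup (N e).nodup]
end

section
/- Let n, λ, k be positive integers and r_1, …, r_k be positive integers. If r_i·n is even for each i ∈ [k] and r_1 + ⋯ + r_k = λ·(n−1), then the hypergraph λK*_n admits a (3r_1,…,3r_k)-factorization, i.e., its edge multiset can be partitioned into F_1,…,F_k where F_i is a spanning 3r_i-regular sub-hypergraph for each i ∈ [k]. -/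
/-- The 3-uniform hypergraph `K*ₙ` on `Fin n`: for all distinct vertices
`u, v, w`, the edge `{u, u, v}` has multiplicity `1`, while `{u, u, u}` and
`{u, v, w}` have multiplicity `0`.  (The map `(u, v) ↦ {u, u, v}` is injective
on pairs of distinct vertices, so each such edge appears exactly once.) -/
def Kstar (n : ℕ) : Multiset (Multiset (Fin n)) :=
  ((Finset.univ.filter fun p : Fin n × Fin n => p.1 ≠ p.2).val).map
    fun p => ({p.1, p.1, p.2} : Multiset (Fin n))

theorem multiset_map_val_eq_sum_singleton {α β : Type*} (s : Finset α) (f : α → β) :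
    s.val.map f = ∑ a ∈ s, ({f a} : Multiset β) := by
  rw [← Multiset.sum_map_singleton (s.val.map f), Multiset.map_map]
  rfl

theorem hdeg_sum {V ι : Type*} [DecidableEq V] (s : Finset ι)
    (E : ι → Multiset (Multiset V)) (v : V) :
    hdeg (∑ i ∈ s, E i) v = ∑ i ∈ s, hdeg (E i) v := by
  classical
  induction s using Finset.induction_on with
  | empty => simp [hdeg]
  | insert a s ha ih =>
    rw [Finset.sum_insert ha, Finset.sum_insert ha, ← ih]
    simp [hdeg]

/-- The sub-hypergraph of `K*ₙ` with edges `{u, u, u + s}`, for a fixed shift `s`. -/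
def shiftFactor (n : ℕ) [NeZero n] (s : Fin n) : Multiset (Multiset (Fin n)) :=
  (Finset.univ : Finset (Fin n)).val.map fun u => {u, u, u + s}

theorem hdeg_shiftFactor (n : ℕ) [NeZero n] (s v : Fin n) :
    hdeg (shiftFactor n s) v = 3 := by
  have hedge : ∀ u : Fin n, Multiset.count v ({u, u, u + s} : Multiset (Fin n)) =
      2 * (if u = v then 1 else 0) + if u = v - s then 1 else 0 := by
    intro u
    simp only [Multiset.insert_eq_cons, Multiset.count_cons, Multiset.count_singleton,
      eq_sub_iff_add_eq, eq_comm (a := v)]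
    ring
  calc hdeg (shiftFactor n s) v
      = ∑ u : Fin n, Multiset.count v ({u, u, u + s} : Multiset (Fin n)) := by
        rw [hdeg, shiftFactor, Multiset.map_map]
        rfl
    _ = 3 := by
        simp only [hedge, Finset.sum_add_distrib, ← Finset.mul_sum, Finset.sum_ite_eq',
          Finset.mem_univ, if_true, mul_one, Nat.reduceAdd]

theorem sum_shiftFactor (n : ℕ) [NeZero n] :
    ∑ s : {s : Fin n // s ≠ 0}, shiftFactor n s = Kstar n := by
  simp only [shiftFactor, Kstar, multiset_map_val_eq_sum_singleton]
  rw [← Fintype.sum_prod_type' fun (s : {s : Fin n // s ≠ 0}) (u : Fin n) =>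
    ({{u, u, u + s.1}} : Multiset (Multiset (Fin n)))]
  refine Finset.sum_bij' (fun p _ => (p.2, p.2 + p.1.1))
    (fun p hp => (⟨p.2 - p.1, sub_ne_zero.mpr (Finset.mem_filter.mp hp).2.symm⟩, p.1))
    ?_ ?_ ?_ ?_ ?_
  · rintro ⟨⟨s, hs⟩, u⟩ _
    simpa using hs
  · simp
  · simp
  · simp
  · simp

/-- **Lemma.** If `rᵢ n` is even for each `i` and `∑ rᵢ = λ (n - 1)`, then
`λK*ₙ` is `(3r₁, …, 3r_k)`-factorable. -/
theorem lamKstar_factorization (n lambda k : ℕ) (hn : 0 < n) (hlambda : 0 < lambda)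
    (hk : 0 < k) (r : Fin k → ℕ) (hr : ∀ i, 0 < r i)
    (heven : ∀ i, Even (r i * n)) (hsum : ∑ i, r i = lambda * (n - 1)) :
    ∃ F : Fin k → Multiset (Multiset (Fin n)),
      (∑ i, F i) = lambda • Kstar n ∧ ∀ i, ∀ v, hdeg (F i) v = 3 * r i := by
  have : NeZero n := ⟨hn.ne'⟩
  have hcard : Fintype.card (Σ i : Fin k, Fin (r i)) =
      Fintype.card (Fin lambda × {s : Fin n // s ≠ 0}) := by
    simp [hsum]
  let e := Fintype.equivOfCardEq hcard
  refine ⟨fun i => ∑ j : Fin (r i), shiftFactor n (e ⟨i, j⟩).2, ?_, fun i v => ?_⟩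
  · rw [← Fintype.sum_sigma' fun i j => shiftFactor n (e ⟨i, j⟩).2]
    rw [e.sum_comp fun p => shiftFactor n p.2, Fintype.sum_prod_type]
    simp [sum_shiftFactor]
  · simp [hdeg_sum, hdeg_shiftFactor, mul_comm]
end
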